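/- (Non-degeneracy II, item 2.) For every j ∈ ℤ \ ({0} ∪ S ∪ (−S)), the map κ ↦ (ω⃗(κ), ω_j(κ), 1) from [κ₁, κ₂] to ℝ^{ν+2} is non-degenerate: for every (c, d, e) ∈ ℝ^ν × ℝ × ℝ with (c, d, e) ≠ 0 there exists κ ∈ [κ₁, κ₂] such that Σ_{a=1}^{ν} c_a · ω_{j̄_a}(κ) + d·ω_j(κ) + e ≠ 0. -/

import Mathlib

open Real Finset Set

/-- `G_j := j · tanh(dpt · j)` (finite depth `dpt`). -/
noncomputable def Gfun (dpt : ℝ) (j : ℤ) : ℝ := (j : ℝ) * Real.tanh (dpt * (j : ℝ))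

/-- The linear frequencies `ω_j(κ)`. -/
noncomputable def omegaF (dpt g γ : ℝ) (j : ℤ) (κ : ℝ) : ℝ :=
  Real.sqrt (κ * Gfun dpt j * (j : ℝ) ^ 2 + g * Gfun dpt j + (γ * Gfun dpt j / (2 * (j : ℝ))) ^ 2)

/-- The linear frequencies `Ω_j(κ) = ω_j(κ) + (γ/2) G_j / j`. -/
noncomputable def OmegaF (dpt g γ : ℝ) (j : ℤ) (κ : ℝ) : ℝ :=
  omegaF dpt g γ j κ + γ / 2 * Gfun dpt j / (j : ℝ)

/-- The ratio of the constant term to the coefficient of `κ` in the radicand of `ω_j(κ)`, as a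
function of `x = |j|`. -/
noncomputable def omegaShift (dpt g γ x : ℝ) : ℝ :=
  g / x ^ 2 + γ ^ 2 / 4 * (Real.tanh (dpt * x) / x / x ^ 2)

theorem Real.tanh_pos_of_pos {x : ℝ} (hx : 0 < x) : 0 < Real.tanh x := by
  rw [Real.tanh_eq_sinh_div_cosh]
  exact div_pos (Real.sinh_pos_iff.2 hx) (Real.cosh_pos x)

theorem Real.convexOn_sinh_Ici : ConvexOn ℝ (Set.Ici 0) Real.sinh := by
  refine MonotoneOn.convexOn_of_deriv (convex_Ici 0) Real.continuous_sinh.continuousOn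
    Real.differentiable_sinh.differentiableOn ?_
  rw [Real.deriv_sinh]
  exact Real.cosh_strictMonoOn.monotoneOn.mono interior_subset

theorem Real.mul_tanh_le_mul_tanh {a b : ℝ} (ha : 0 < a) (hab : a < b) :
    a * Real.tanh b ≤ b * Real.tanh a := by
  have h := Real.convexOn_sinh_Ici.secant_mono_aux1 (x := 0) (y := b - a) (z := b + a)
    (by simp) (by simp; linarith) (by linarith) (by linarith)
  rw [Real.sinh_zero, Real.sinh_add, Real.sinh_sub] at h
  rw [Real.tanh_eq_sinh_div_cosh, Real.tanh_eq_sinh_div_cosh, mul_div_assoc', mul_div_assoc',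
    div_le_div_iff₀ (Real.cosh_pos b) (Real.cosh_pos a)]
  linarith

theorem omegaShift_pos {dpt g : ℝ} (hdpt : 0 < dpt) (hg : 0 < g) (γ : ℝ) {x : ℝ} (hx : 0 < x) :
    0 < omegaShift dpt g γ x := by
  have := Real.tanh_pos_of_pos (mul_pos hdpt hx)
  unfold omegaShift
  positivity

theorem omegaShift_strictAntiOn {dpt g : ℝ} (hdpt : 0 < dpt) (hg : 0 < g) (γ : ℝ) :
    StrictAntiOn (omegaShift dpt g γ) (Set.Ioi 0) := by
  intro a ha b hb hab
  have ha : 0 < a := ha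
  have hb : 0 < b := hb
  have htanh : Real.tanh (dpt * b) / b ≤ Real.tanh (dpt * a) / a := by
    rw [div_le_div_iff₀ hb ha]
    have := Real.mul_tanh_le_mul_tanh (mul_pos hdpt ha) (mul_lt_mul_of_pos_left hab hdpt)
    refine le_of_mul_le_mul_left ?_ hdpt
    linarith
  have hpos := Real.tanh_pos_of_pos (mul_pos hdpt ha)
  unfold omegaShift
  have hsq : a ^ 2 < b ^ 2 := by gcongr
  have h₁ : g / b ^ 2 < g / a ^ 2 := by gcongr
  have h₂ : Real.tanh (dpt * b) / b / b ^ 2 ≤ Real.tanh (dpt * a) / a / a ^ 2 := by gcongr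
  have h₃ := mul_le_mul_of_nonneg_left h₂ (show 0 ≤ γ ^ 2 / 4 by positivity)
  linarith

theorem Gfun_eq_abs (dpt : ℝ) (j : ℤ) : Gfun dpt j = |(j : ℝ)| * Real.tanh (dpt * |(j : ℝ)|) := by
  unfold Gfun
  rcases abs_choice (j : ℝ) with h | h <;> rw [h]
  rw [mul_neg, Real.tanh_neg, neg_mul_neg]

theorem Gfun_pos {dpt : ℝ} (hdpt : 0 < dpt) {j : ℤ} (hj : j ≠ 0) : 0 < Gfun dpt j := by
  have hx : 0 < |(j : ℝ)| := abs_pos.2 (Int.cast_ne_zero.2 hj)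
  rw [Gfun_eq_abs]
  exact mul_pos hx (Real.tanh_pos_of_pos (mul_pos hdpt hx))

theorem omegaF_eq_mul_rpow {dpt : ℝ} (hdpt : 0 < dpt) (g γ : ℝ) {j : ℤ} (hj : j ≠ 0) (κ : ℝ) :
    omegaF dpt g γ j κ = √(Gfun dpt j * (j : ℝ) ^ 2) *
      (κ + omegaShift dpt g γ |(j : ℝ)|) ^ (1 / 2 : ℝ) := by
  have hx : 0 < |(j : ℝ)| := abs_pos.2 (Int.cast_ne_zero.2 hj)
  have hG := Gfun_pos hdpt hj
  have htanh : Real.tanh (dpt * |(j : ℝ)|) = Gfun dpt j / |(j : ℝ)| := by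
    rw [Gfun_eq_abs]
    field_simp
  rw [← Real.sqrt_eq_rpow, ← Real.sqrt_mul (by positivity)]
  unfold omegaF omegaShift
  rw [htanh, div_pow, mul_pow 2 (j : ℝ), ← sq_abs (j : ℝ)]
  congr 1
  field_simp
  ring

/-- Differentiating a relation between translated powers lowers the exponent by one. -/
theorem sum_mul_rpow_sub_one_eq_zero {n : ℕ} {c B : Fin n → ℝ} {s : Set ℝ} (hs : IsOpen s)
    (hB : ∀ i, ∀ κ ∈ s, 0 < κ + B i) {p e : ℝ} (hp : p ≠ 0)
    (h : ∀ κ ∈ s, (∑ i, c i * (κ + B i) ^ p) + e = 0) :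
    ∀ κ ∈ s, ∑ i, c i * (κ + B i) ^ (p - 1) = 0 := by
  intro κ hκ
  have hderiv : HasDerivAt (fun x => (∑ i, c i * (x + B i) ^ p) + e)
      (∑ i, c i * (1 * p * (κ + B i) ^ (p - 1))) κ :=
    (HasDerivAt.fun_sum fun i _ => (((hasDerivAt_id κ).add_const (B i)).rpow_const
      (Or.inl (hB i κ hκ).ne')).const_mul (c i)).add_const e
  have hzero : HasDerivAt (fun x => (∑ i, c i * (x + B i) ^ p) + e) 0 κ :=
    (hasDerivAt_const κ (0 : ℝ)).congr_of_eventuallyEq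
      (Filter.eventually_of_mem (hs.mem_nhds hκ) h)
  have hsum := hderiv.unique hzero
  refine (mul_eq_zero.1 ?_).resolve_left hp
  rw [Finset.mul_sum, ← hsum]
  exact Finset.sum_congr rfl fun i _ => by ring

/-- Square roots of distinct translates are linearly independent modulo constants. -/
theorem eq_zero_of_sum_mul_rpow_half_eq_const {n : ℕ} {c B : Fin n → ℝ} {s : Set ℝ}
    (hs : IsOpen s) (hne : s.Nonempty) (hinj : Function.Injective B)
    (hB : ∀ i, ∀ κ ∈ s, 0 < κ + B i) {e : ℝ}
    (h : ∀ κ ∈ s, (∑ i, c i * (κ + B i) ^ (1 / 2 : ℝ)) + e = 0) : c = 0 := by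
  have hall : ∀ m : ℕ, ∀ κ ∈ s, ∑ i, c i * (κ + B i) ^ (1 / 2 - 1 - m : ℝ) = 0 := by
    intro m
    induction m with
    | zero => simpa using sum_mul_rpow_sub_one_eq_zero hs hB (by norm_num) h
    | succ m ih =>
      have hp : (1 / 2 - 1 - m : ℝ) ≠ 0 := by
        have : (0 : ℝ) ≤ m := m.cast_nonneg
        linarith
      have := sum_mul_rpow_sub_one_eq_zero (e := 0) hs hB hp (by simpa using ih)
      push_cast
      simpa only [sub_sub, add_assoc] using this
  obtain ⟨κ, hκ⟩ := hne
  have hv := Matrix.eq_zero_of_forall_pow_sum_mul_pow_eq_zero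
    (f := fun i => (κ + B i)⁻¹) (v := fun i => c i * (κ + B i) ^ (1 / 2 - 1 : ℝ))
    (fun i k hik => hinj (add_left_cancel (inv_injective hik))) (fun m => by
      rw [← hall m κ hκ]
      refine Finset.sum_congr rfl fun i _ => ?_
      rw [Real.rpow_sub_natCast (hB i κ hκ).ne', inv_pow, mul_assoc, ← div_eq_mul_inv])
  funext i
  exact (mul_eq_zero.1 (congrFun hv i)).resolve_right (Real.rpow_pos_of_pos (hB i κ hκ) _).ne'

/-- Linear independence, modulo constants, of frequencies at sites of distinct absolute value. -/
theorem eq_zero_of_sum_mul_omegaF_eq_const {dpt g γ κ₁ κ₂ : ℝ} (hdpt : 0 < dpt) (hg : 0 < g)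
    (hκ₁ : 0 ≤ κ₁) (hκ₁₂ : κ₁ < κ₂) {n : ℕ} {j : Fin n → ℤ} (hj : ∀ i, j i ≠ 0)
    (hinj : Function.Injective fun i => |j i|) {c : Fin n → ℝ} {e : ℝ}
    (h : ∀ κ ∈ Set.Icc κ₁ κ₂, (∑ i, c i * omegaF dpt g γ (j i) κ) + e = 0) :
    c = 0 ∧ e = 0 := by
  have hx : ∀ i, 0 < |(j i : ℝ)| := fun i => abs_pos.2 (Int.cast_ne_zero.2 (hj i))
  have hc := eq_zero_of_sum_mul_rpow_half_eq_const
    (c := fun i => c i * √(Gfun dpt (j i) * (j i : ℝ) ^ 2))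
    (B := fun i => omegaShift dpt g γ |(j i : ℝ)|) (s := Set.Ioo κ₁ κ₂) (e := e)
    isOpen_Ioo (Set.nonempty_Ioo.2 hκ₁₂)
    (fun i k hik => hinj (by
      have := (omegaShift_strictAntiOn hdpt hg γ).injOn (hx i) (hx k) hik
      exact_mod_cast this))
    (fun i κ hκ => by
      have := omegaShift_pos hdpt hg γ (hx i)
      linarith [hκ.1])
    (fun κ hκ => by
      rw [← h κ (Set.Ioo_subset_Icc_self hκ)]
      simp only [omegaF_eq_mul_rpow hdpt g γ (hj _), mul_assoc])
  have hc0 : c = 0 := by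
    funext i
    have hG := Gfun_pos hdpt (hj i)
    have hj' : (j i : ℝ) ≠ 0 := Int.cast_ne_zero.2 (hj i)
    refine (mul_eq_zero.1 (congrFun hc i)).resolve_right (Real.sqrt_pos.2 ?_).ne'
    positivity
  refine ⟨hc0, ?_⟩
  simpa [hc0] using h κ₁ (Set.left_mem_Icc.2 hκ₁₂.le)

/-- Non-degeneracy II, item 2: for any j not in {0} ∪ S ∪ (−S), the curve
κ ↦ (ω⃗(κ), ω_j(κ), 1) is non-degenerate. -/
theorem nondegeneracy_II_item2
    (dpt g γ κ₁ κ₂ : ℝ) (hdpt : 0 < dpt) (hg : 0 < g) (hκ₁ : 0 < κ₁) (hκ₁₂ : κ₁ < κ₂)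
    (ν : ℕ) (hν : 1 ≤ ν) (jbar : Fin ν → ℤ)
    (hjne : ∀ a, jbar a ≠ 0)
    (hjinj : Function.Injective fun a => |jbar a|) :
    ∀ j : ℤ, j ≠ 0 → (∀ a, j ≠ jbar a) → (∀ a, j ≠ -jbar a) →
      ∀ (c : Fin ν → ℝ) (d e : ℝ), (c ≠ 0 ∨ d ≠ 0 ∨ e ≠ 0) →
        ∃ κ ∈ Set.Icc κ₁ κ₂,
          (∑ a, c a * omegaF dpt g γ (jbar a) κ) + d * omegaF dpt g γ j κ + e ≠ 0 := by
  intro j hj hjS hjS' c d e hcde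
  by_contra! hcon
  have hsites : Function.Injective fun i => |(Fin.cons j jbar : Fin (ν + 1) → ℤ) i| := by
    have hne : ∀ a, |j| ≠ |jbar a| := fun a hja =>
      (abs_eq_abs.1 hja).elim (hjS a) (hjS' a)
    intro i k hik
    induction i using Fin.cases with
    | zero =>
      induction k using Fin.cases with
      | zero => rfl
      | succ k => exact absurd hik (hne k)
    | succ i =>
      induction k using Fin.cases with
      | zero => exact absurd hik.symm (hne i)
      | succ k => exact congrArg Fin.succ (hjinj hik)
  obtain ⟨hc, he⟩ := eq_zero_of_sum_mul_omegaF_eq_const (γ := γ) (c := Fin.cons d c) (e := e)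
    hdpt hg hκ₁.le hκ₁₂ (Fin.cases hj hjne) hsites (fun κ hκ => by
      rw [← hcon κ hκ, Fin.sum_univ_succ]
      simp only [Fin.cons_zero, Fin.cons_succ]
      ring)
  have hd : d = 0 := congrFun hc 0
  have hc0 : c = 0 := funext fun a => congrFun hc a.succ
  simp [hd, hc0, he] at hcde
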